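/- Let A be a local artinian ring, M a finitely generated A-module having reducible complexity, with complexity c and infinite CI-dimension. Let x_1, …, x_r be indeterminates, let A' be the localization of A[x_1, …, x_r] at the maximal ideal generated by the maximal ideal of A and x_1, …, x_r, and let M' be the corresponding localization of M[x_1, …, x_r]. Then M' is a finitely generated module over the local ring A' of Krull dimension r, M' has reducible complexity, complexity c, and infinite CI-dimension. -/

import Mathlib

open IsLocalRing CategoryTheory

universe u

noncomputable section

/-! Basic commutative-algebra notions: depth, minimal free resolutions, Betti numbers,
complexity, syzygies, reducible complexity, upper reducing degree, Tor-independence,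
Gorenstein dimension, CI-dimension, Cohen-Macaulay local rings. -/




/-- The depth of a module over a local ring: the supremum of lengths of regular
sequences on the module consisting of elements of the maximal ideal. -/
def moduleDepth (A : Type u) [CommRing A] [IsLocalRing A]
    (M : Type u) [AddCommGroup M] [Module A M] : ℕ∞ :=
  sSup {n : ℕ∞ | ∃ rs : List A, (rs.length : ℕ∞) = n ∧
    (∀ x ∈ rs, x ∈ maximalIdeal A) ∧ RingTheory.Sequence.IsRegular M rs}

/-- A minimal free resolution of a module over a local ring. -/
structure MinFreeRes (A : Type u) [CommRing A] [IsLocalRing A]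
    (M : Type u) [AddCommGroup M] [Module A M] : Type (u + 1) where
  F : ℕ → ModuleCat.{u} A
  free : ∀ n, Module.Free A (F n)
  fin : ∀ n, Module.Finite A (F n)
  d : ∀ n, F (n + 1) →ₗ[A] F n
  aug : F 0 →ₗ[A] M
  aug_surj : Function.Surjective aug
  exact_aug : Function.Exact (d 0) aug
  exact_d : ∀ n, Function.Exact (d (n + 1)) (d n)
  minimal : ∀ n x, d n x ∈ (maximalIdeal A) • (⊤ : Submodule A (F n))

/-- The Betti numbers of a minimal free resolution. -/
def MinFreeRes.betti {A : Type u} [CommRing A] [IsLocalRing A]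
    {M : Type u} [AddCommGroup M] [Module A M] (R : MinFreeRes A M) (n : ℕ) : ℕ :=
  Module.finrank A (R.F n)

/-- The sequence `β` is eventually bounded by `a * n ^ (t - 1)` for some real `a`. -/
def CxBound (β : ℕ → ℕ) (t : ℕ) : Prop :=
  ∃ a : ℝ, ∃ N : ℕ, ∀ n, N ≤ n → (β n : ℝ) ≤ a * (n : ℝ) ^ ((t : ℝ) - 1)

/-- The complexity of a module: the least `t` such that the Betti sequence of a minimal
free resolution is eventually bounded by `a * n ^ (t - 1)` for some `a` (and `⊤` if no
such `t` exists). -/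
def complexity (A : Type u) [CommRing A] [IsLocalRing A]
    (M : Type u) [AddCommGroup M] [Module A M] : ℕ∞ :=
  sInf {t : ℕ∞ | ∃ t' : ℕ, t = (t' : ℕ∞) ∧ ∃ R : MinFreeRes A M, CxBound R.betti t'}

/-- A finite resolution of a module `M`:
an exact sequence `0 → G len → ⋯ → G 0 → M → 0`. -/
structure FinRes (A : Type u) [CommRing A]
    (M : Type u) [AddCommGroup M] [Module A M] : Type (u + 1) where
  len : ℕ
  G : ℕ → ModuleCat.{u} A
  d : ∀ n, G (n + 1) →ₗ[A] G n
  aug : G 0 →ₗ[A] M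
  bounded : ∀ n, len < n → Subsingleton (G n)
  aug_surj : Function.Surjective aug
  exact_aug : Function.Exact (d 0) aug
  exact_d : ∀ n, Function.Exact (d (n + 1)) (d n)

/-- A module has finite projective dimension if it admits a finite resolution by
projective modules. -/
def HasFiniteProjDim (A : Type u) [CommRing A]
    (M : Type u) [AddCommGroup M] [Module A M] : Prop :=
  ∃ R : FinRes A M, ∀ n, Module.Projective A (R.G n)

/-- `S` is an `n`-th syzygy of `M`: for `n = 0`, `S ≅ M`; for `n ≥ 1`, `S` is isomorphic to
the image of the `n`-th differential in a minimal free resolution of `M`. -/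
def IsSyzygy (A : Type u) [CommRing A] [IsLocalRing A]
    (M : Type u) [AddCommGroup M] [Module A M]
    (S : Type u) [AddCommGroup S] [Module A S] : ℕ → Prop
  | 0 => Nonempty (S ≃ₗ[A] M)
  | (n + 1) => ∃ R : MinFreeRes A M, Nonempty (S ≃ₗ[A] LinearMap.range (R.d n))

/-- `K` is obtained from `M` by a reduction of complexity coming from a cohomology class
of degree `t ≥ 1`, i.e. there is a short exact sequence `0 → M → K → Ω^{t-1}(M) → 0`. -/
def ReducesWithDeg (A : Type u) [CommRing A] [IsLocalRing A]
    (M K : ModuleCat.{u} A) (t : ℕ) : Prop :=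
  1 ≤ t ∧ ∃ (S : Type u) (_ : AddCommGroup S) (_ : Module A S),
    IsSyzygy A M S (t - 1) ∧
    ∃ (f : M →ₗ[A] K) (g : K →ₗ[A] S),
      Function.Injective f ∧ Function.Surjective g ∧ Function.Exact f g

/-- The class of (bundled) modules having reducible complexity: the smallest class
containing all modules of finite projective dimension, and containing every module `M` of
finite positive complexity admitting a short exact sequence
`0 → M → K → Ω^{t-1}(M) → 0` (coming from a degree-`t` self-extension) with
`cx K < cx M` and `K` of reducible complexity. -/
inductive HasRedCxCat (A : Type u) [CommRing A] [IsLocalRing A] : ModuleCat.{u} A → Prop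
  | of_finite_pd (M : ModuleCat.{u} A) : HasFiniteProjDim A M → HasRedCxCat A M
  | of_step (M K : ModuleCat.{u} A) (t : ℕ) :
      complexity A M ≠ 0 → complexity A M ≠ ⊤ →
      ReducesWithDeg A M K t →
      complexity A K < complexity A M →
      HasRedCxCat A K → HasRedCxCat A M

/-- A module has reducible complexity. -/
def HasReducibleComplexity (A : Type u) [CommRing A] [IsLocalRing A]
    (M : Type u) [AddCommGroup M] [Module A M] : Prop :=
  HasRedCxCat A (ModuleCat.of A M)

/-- A sequence of short exact sequences `0 → K_{i-1} → K_i → Ω^{d_i - 1}(K_{i-1}) → 0`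
with strictly decreasing complexities, ending in a module of complexity zero, i.e. a
sequence reducing the complexity of `Ks 0`. -/
def IsReducingSeq (A : Type u) [CommRing A] [IsLocalRing A] (t : ℕ)
    (Ks : Fin (t + 1) → ModuleCat.{u} A) (degs : Fin t → ℕ) : Prop :=
  (∀ i : Fin t, ReducesWithDeg A (Ks i.castSucc) (Ks i.succ) (degs i)) ∧
  (∀ i : Fin t, complexity A (Ks i.succ) < complexity A (Ks i.castSucc)) ∧
  complexity A (Ks (Fin.last t)) = 0

open Classical in
/-- The upper reducing degree of `M`: `⊤` if `M` has finite projective dimension, and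
otherwise the supremum, over all sequences reducing the complexity of `M`, of the minimum
of the degrees of the cohomology classes involved. -/
def upperReducingDegree (A : Type u) [CommRing A] [IsLocalRing A]
    (M : Type u) [AddCommGroup M] [Module A M] : ℕ∞ :=
  if HasFiniteProjDim A M then ⊤
  else sSup {r : ℕ∞ | ∃ (t : ℕ) (Ks : Fin (t + 1) → ModuleCat.{u} A) (degs : Fin t → ℕ),
    Ks 0 = ModuleCat.of A M ∧ IsReducingSeq A t Ks degs ∧
    r = ⨅ i : Fin t, (degs i : ℕ∞)}

/-- The `n`-th Tor module of two modules. -/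
def torModule (A : Type u) [CommRing A] (M N : Type u)
    [AddCommGroup M] [Module A M] [AddCommGroup N] [Module A N] (n : ℕ) : ModuleCat.{u} A :=
  ((Tor (ModuleCat.{u} A) n).obj (ModuleCat.of A M)).obj (ModuleCat.of A N)

/-- Two modules are Tor-independent if `Tor_n(M, N) = 0` for all `n > 0`. -/
def TorIndep (A : Type u) [CommRing A] (M N : Type u)
    [AddCommGroup M] [Module A M] [AddCommGroup N] [Module A N] : Prop :=
  ∀ n : ℕ, 0 < n → Subsingleton (torModule A M N n)

/-- The `n`-th Ext module of two modules. -/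
def extModule (A : Type u) [CommRing A] (M N : Type u)
    [AddCommGroup M] [Module A M] [AddCommGroup N] [Module A N] (n : ℕ) : ModuleCat.{u} A :=
  ((Ext A (ModuleCat.{u} A) n).obj (Opposite.op (ModuleCat.of A M))).obj (ModuleCat.of A N)

/-- A module `G` has Gorenstein dimension zero if it is reflexive and
`Ext^n(G, A) = 0 = Ext^n(Hom(G, A), A)` for all `n > 0`. -/
def GDimZero (A : Type u) [CommRing A] (G : Type u) [AddCommGroup G] [Module A G] : Prop :=
  Module.IsReflexive A G ∧
  ∀ n : ℕ, 0 < n →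
    Subsingleton (extModule A G A n) ∧ Subsingleton (extModule A (Module.Dual A G) A n)

/-- A module has finite Gorenstein dimension if it admits a finite resolution by modules
of Gorenstein dimension zero. -/
def HasFiniteGDim (A : Type u) [CommRing A]
    (M : Type u) [AddCommGroup M] [Module A M] : Prop :=
  ∃ R : FinRes A M, ∀ n, GDimZero A (R.G n)


/-- The Krull dimension of a ring, viewed in `WithBot ℕ∞`. -/
def ringKrullDimE (A : Type u) [CommRing A] : WithBot ℕ∞ := ringKrullDim A

/-- A local ring is Cohen-Macaulay if its depth equals its Krull dimension. -/
def IsCMLocalRing (A : Type u) [CommRing A] [IsLocalRing A] : Prop :=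
  (moduleDepth A A : WithBot ℕ∞) = ringKrullDimE A

/-- A module over a local ring is maximal Cohen-Macaulay if its depth equals the Krull
dimension of the ring. -/
def IsMaxCM (A : Type u) [CommRing A] [IsLocalRing A]
    (M : Type u) [AddCommGroup M] [Module A M] : Prop :=
  (moduleDepth A M : WithBot ℕ∞) = ringKrullDimE A

/-- A local ring is Gorenstein if and only if every finitely generated module over it has
finite Gorenstein dimension. -/
def IsGorensteinLocalRing (A : Type u) [CommRing A] [IsLocalRing A] : Prop :=
  ∀ M : ModuleCat.{u} A, Module.Finite A M → HasFiniteGDim A M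

/-- A module `M` over a local ring `A` has finite CI-dimension if there is a diagram of
local ring homomorphisms `A → R ← Q` with `A → R` flat and `Q → R` surjective with kernel
generated by a regular sequence, such that `R ⊗_A M` has finite projective dimension
over `Q`. -/
def HasFiniteCIDimMod (A : Type u) [CommRing A] [IsLocalRing A]
    (M : Type u) [AddCommGroup M] [Module A M] : Prop :=
  ∃ (R Q : Type u) (_ : CommRing R) (_ : CommRing Q) (_ : IsLocalRing R) (_ : IsLocalRing Q)
    (f : A →+* R) (g : Q →+* R),
    IsLocalHom f ∧ IsLocalHom g ∧ Function.Surjective g ∧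
    (∃ rs : List Q, RingTheory.Sequence.IsRegular Q rs ∧
      RingHom.ker g = Ideal.span {x | x ∈ rs}) ∧
    (letI : Algebra A R := f.toAlgebra
     Module.Flat A R ∧
     (letI : Module Q (TensorProduct A R M) := Module.compHom _ g
      HasFiniteProjDim Q (TensorProduct A R M)))


/-- The maximal ideal of `A[x₁, …, x_r]` generated by the maximal ideal of the local ring
`A` and the variables `x₁, …, x_r`: the kernel of the map to the residue field of `A`
evaluating all variables at `0`. -/
def polyMaxIdeal (A : Type u) [CommRing A] [IsLocalRing A] (r : ℕ) :
    Ideal (MvPolynomial (Fin r) A) :=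
  RingHom.ker ((IsLocalRing.residue A).comp (MvPolynomial.aeval (0 : Fin r → A)).toRingHom)

instance (A : Type u) [CommRing A] [IsLocalRing A] (r : ℕ) : (polyMaxIdeal A r).IsPrime :=
  RingHom.ker_isPrime _

/-- The localization `A'` of `A[x₁, …, x_r]` at the maximal ideal generated by the
maximal ideal of `A` and `x₁, …, x_r`. -/
abbrev polyLoc (A : Type u) [CommRing A] [IsLocalRing A] (r : ℕ) : Type u :=
  Localization (polyMaxIdeal A r).primeCompl

/-- The corresponding localization `M'` of `M[x₁, …, x_r] = A[x₁, …, x_r] ⊗_A M`, as a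
module over `A' = polyLoc A r`. -/
abbrev polyLocMod (A : Type u) [CommRing A] [IsLocalRing A]
    (M : Type u) [AddCommGroup M] [Module A M] (r : ℕ) : Type u :=
  LocalizedModule (polyMaxIdeal A r).primeCompl
    (TensorProduct A (MvPolynomial (Fin r) A) M)

section UniquenessOfMinimalResolutions

variable {A : Type u} [CommRing A] [IsLocalRing A]

/-- A lift along a minimal cover `p : F → M` of a surjection onto `M` is surjective. -/
lemma surjective_of_comp_surjective_of_ker_le {E F M : Type*}
    [AddCommGroup E] [Module A E] [AddCommGroup F] [Module A F] [Module.Finite A F]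
    [AddCommGroup M] [Module A M] (p : F →ₗ[A] M) (φ : E →ₗ[A] F)
    (hsurj : Function.Surjective (p ∘ₗ φ))
    (hker : LinearMap.ker p ≤ maximalIdeal A • (⊤ : Submodule A F)) :
    Function.Surjective φ := by
  rw [← LinearMap.range_eq_top, ← top_le_iff]
  refine Submodule.le_of_le_smul_of_le_jacobson_bot (I := maximalIdeal A)
    Module.Finite.fg_top (IsLocalRing.maximalIdeal_le_jacobson _) fun y _ => ?_
  obtain ⟨x, hx⟩ := hsurj (p y)
  have hxy : y - φ x ∈ LinearMap.ker p := by
    rw [LinearMap.mem_ker, map_sub, sub_eq_zero]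
    exact hx.symm
  rw [← add_sub_cancel (φ x) y]
  exact Submodule.add_mem_sup (LinearMap.mem_range_self φ x) (hker hxy)

/-- Minimal free covers of isomorphic modules are isomorphic. -/
lemma exists_equiv_of_minimal_covers {E F M N : Type*}
    [AddCommGroup E] [Module A E] [Module.Finite A E] [Module.Free A E]
    [AddCommGroup F] [Module A F] [Module.Finite A F] [Module.Free A F]
    [AddCommGroup M] [Module A M] [AddCommGroup N] [Module A N]
    (p : E →ₗ[A] M) (q : F →ₗ[A] N) (e : M ≃ₗ[A] N)
    (hp : Function.Surjective p) (hq : Function.Surjective q)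
    (hpk : LinearMap.ker p ≤ maximalIdeal A • (⊤ : Submodule A E))
    (hqk : LinearMap.ker q ≤ maximalIdeal A • (⊤ : Submodule A F)) :
    ∃ φ : E ≃ₗ[A] F, ∀ x, q (φ x) = e (p x) := by
  obtain ⟨φ, hφ⟩ := Module.projective_lifting_property q (e.toLinearMap ∘ₗ p) hq
  obtain ⟨ψ, hψ⟩ := Module.projective_lifting_property p (e.symm.toLinearMap ∘ₗ q) hp
  have hφs : Function.Surjective φ := by
    refine surjective_of_comp_surjective_of_ker_le q φ ?_ hqk
    rw [hφ]
    exact e.surjective.comp hp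
  have hψs : Function.Surjective ψ := by
    refine surjective_of_comp_surjective_of_ker_le p ψ ?_ hpk
    rw [hψ]
    exact e.symm.surjective.comp hq
  have hinj : Function.Injective (ψ ∘ₗ φ) :=
    OrzechProperty.injective_of_surjective_endomorphism _ (hψs.comp hφs)
  have hφi : Function.Injective φ := Function.Injective.of_comp (f := ψ) hinj
  exact ⟨LinearEquiv.ofBijective φ ⟨hφi, hφs⟩, fun x => LinearMap.congr_fun hφ x⟩

variable {M : Type u} [AddCommGroup M] [Module A M]

lemma MinFreeRes.range_d_le (R : MinFreeRes A M) (n : ℕ) :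
    LinearMap.range (R.d n) ≤ maximalIdeal A • (⊤ : Submodule A (R.F n)) := by
  rintro _ ⟨x, rfl⟩
  exact R.minimal n x

lemma MinFreeRes.exists_equiv (R R' : MinFreeRes A M) (n : ℕ) :
    ∃ φ : R.F n ≃ₗ[A] R'.F n,
      (LinearMap.range (R.d n)).map φ.toLinearMap = LinearMap.range (R'.d n) := by
  have := R.free
  have := R.fin
  have := R'.free
  have := R'.fin
  induction n with
  | zero =>
    obtain ⟨φ, hφ⟩ := exists_equiv_of_minimal_covers R.aug R'.aug (LinearEquiv.refl A M)
      R.aug_surj R'.aug_surj (R.exact_aug.linearMap_ker_eq ▸ R.range_d_le 0)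
      (R'.exact_aug.linearMap_ker_eq ▸ R'.range_d_le 0)
    refine ⟨φ, ?_⟩
    rw [← R.exact_aug.linearMap_ker_eq, ← R'.exact_aug.linearMap_ker_eq]
    ext y
    obtain ⟨x, rfl⟩ := φ.surjective y
    simp [hφ]
  | succ n ih =>
    obtain ⟨φ, hφ⟩ := ih
    let e : LinearMap.range (R.d n) ≃ₗ[A] LinearMap.range (R'.d n) :=
      φ.submoduleMap _ ≪≫ₗ LinearEquiv.ofEq _ _ hφ
    obtain ⟨ψ, hψ⟩ := exists_equiv_of_minimal_covers (R.d n).rangeRestrict (R'.d n).rangeRestrict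
      e (R.d n).surjective_rangeRestrict (R'.d n).surjective_rangeRestrict
      (by rw [LinearMap.ker_rangeRestrict, (R.exact_d n).linearMap_ker_eq]
          exact R.range_d_le (n + 1))
      (by rw [LinearMap.ker_rangeRestrict, (R'.exact_d n).linearMap_ker_eq]
          exact R'.range_d_le (n + 1))
    refine ⟨ψ, ?_⟩
    rw [← (R.exact_d n).linearMap_ker_eq, ← (R'.exact_d n).linearMap_ker_eq]
    ext y
    obtain ⟨x, rfl⟩ := ψ.surjective y
    have hx : (R'.d n) (ψ x) = φ (R.d n x) := congrArg Subtype.val (hψ x)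
    simp [hx]

/-- The Betti numbers do not depend on the minimal free resolution. -/
lemma MinFreeRes.betti_eq (R R' : MinFreeRes A M) : R.betti = R'.betti := by
  funext n
  obtain ⟨φ, -⟩ := R.exists_equiv R' n
  exact φ.finrank_eq

lemma nonempty_minFreeRes_of_complexity_ne_top (h : complexity A M ≠ ⊤) :
    Nonempty (MinFreeRes A M) := by
  by_contra hR
  refine h ?_
  rw [complexity, sInf_eq_top]
  rintro _ ⟨-, -, R, -⟩
  exact (hR ⟨R⟩).elim

end UniquenessOfMinimalResolutions

section FlatLocalBaseChange

open TensorProduct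

variable {A : Type u} [CommRing A] (B : Type u) [CommRing B] [Algebra A B]

lemma surjective_baseChange {M N : Type*} [AddCommGroup M] [Module A M]
    [AddCommGroup N] [Module A N] {f : M →ₗ[A] N} (hf : Function.Surjective f) :
    Function.Surjective (f.baseChange B) :=
  LinearMap.lTensor_surjective B hf

lemma exact_baseChange [Module.Flat A B] {L M N : Type*} [AddCommGroup L] [Module A L]
    [AddCommGroup M] [Module A M] [AddCommGroup N] [Module A N]
    {f : L →ₗ[A] M} {g : M →ₗ[A] N} (h : Function.Exact f g) :
    Function.Exact (f.baseChange B) (g.baseChange B) :=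
  Module.Flat.lTensor_exact B h

lemma exact_equiv_comp {L M N P : Type*} [AddCommGroup L] [Module A L]
    [AddCommGroup M] [Module A M] [AddCommGroup N] [Module A N] [AddCommGroup P] [Module A P]
    {f : L →ₗ[A] M} {g : M →ₗ[A] N} (h : Function.Exact f g) (e : N ≃ₗ[A] P) :
    Function.Exact f (e.toLinearMap ∘ₗ g) := fun x => by
  simpa using h x

/-- The base change of a finite resolution along a flat ring homomorphism. -/
def FinRes.baseChange [Module.Flat A B] {M : Type u} [AddCommGroup M] [Module A M]
    (R : FinRes A M) : FinRes B (B ⊗[A] M) where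
  len := R.len
  G n := ModuleCat.of B (B ⊗[A] R.G n)
  d n := (R.d n).baseChange B
  aug := R.aug.baseChange B
  bounded n hn :=
    have := R.bounded n hn
    inferInstanceAs (Subsingleton (B ⊗[A] R.G n))
  aug_surj := surjective_baseChange B R.aug_surj
  exact_aug := exact_baseChange B R.exact_aug
  exact_d n := exact_baseChange B (R.exact_d n)

lemma HasFiniteProjDim.baseChange [Module.Flat A B] {M : Type u} [AddCommGroup M] [Module A M]
    (h : HasFiniteProjDim A M) : HasFiniteProjDim B (B ⊗[A] M) := by
  obtain ⟨R, hR⟩ := h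
  exact ⟨R.baseChange B, fun n =>
    have := hR n
    inferInstanceAs (Module.Projective B (B ⊗[A] R.G n))⟩

lemma HasFiniteProjDim.of_equiv {M N : Type u} [AddCommGroup M] [Module A M]
    [AddCommGroup N] [Module A N] (e : M ≃ₗ[A] N) (h : HasFiniteProjDim A M) :
    HasFiniteProjDim A N := by
  obtain ⟨R, hR⟩ := h
  exact ⟨{ R with
    aug := e.toLinearMap ∘ₗ R.aug
    aug_surj := e.surjective.comp R.aug_surj
    exact_aug := exact_equiv_comp R.exact_aug e }, hR⟩

variable [IsLocalRing A] [IsLocalRing B]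

lemma baseChange_mem_smul_top [IsLocalHom (algebraMap A B)] {E F : Type*}
    [AddCommGroup E] [Module A E] [AddCommGroup F] [Module A F] (f : E →ₗ[A] F)
    (hf : ∀ x, f x ∈ maximalIdeal A • (⊤ : Submodule A F)) (x : B ⊗[A] E) :
    f.baseChange B x ∈ maximalIdeal B • (⊤ : Submodule B (B ⊗[A] F)) := by
  induction x with
  | zero => simp
  | add x y hx hy => simpa using add_mem hx hy
  | tmul b y =>
    rw [LinearMap.baseChange_tmul]
    refine Submodule.smul_induction_on (p := fun z =>
      b ⊗ₜ[A] z ∈ maximalIdeal B • (⊤ : Submodule B (B ⊗[A] F))) (hf y)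
      (fun a ha z _ => ?_) fun z w hz hw => ?_
    · rw [tmul_smul, ← algebraMap_smul B a]
      exact Submodule.smul_mem_smul (map_nonunit (algebraMap A B) a ha) trivial
    · rw [tmul_add]
      exact add_mem hz hw

variable {B} in
/-- The base change of a minimal free resolution along a flat local homomorphism. -/
def MinFreeRes.baseChange [IsLocalHom (algebraMap A B)] [Module.Flat A B]
    {M : Type u} [AddCommGroup M] [Module A M]
    {N : Type u} [AddCommGroup N] [Module B N] (e : B ⊗[A] M ≃ₗ[B] N)
    (R : MinFreeRes A M) : MinFreeRes B N where
  F n := ModuleCat.of B (B ⊗[A] R.F n)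
  free n :=
    have := R.free n
    inferInstanceAs (Module.Free B (B ⊗[A] R.F n))
  fin n :=
    have := R.fin n
    inferInstanceAs (Module.Finite B (B ⊗[A] R.F n))
  d n := (R.d n).baseChange B
  aug := e.toLinearMap ∘ₗ R.aug.baseChange B
  aug_surj := e.surjective.comp (surjective_baseChange B R.aug_surj)
  exact_aug := exact_equiv_comp (exact_baseChange B R.exact_aug) e
  exact_d n := exact_baseChange B (R.exact_d n)
  minimal n x := baseChange_mem_smul_top B (R.d n) (R.minimal n) x

variable {B} [IsLocalHom (algebraMap A B)] [Module.Flat A B]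
  {M : Type u} [AddCommGroup M] [Module A M] {N : Type u} [AddCommGroup N] [Module B N]

lemma MinFreeRes.betti_baseChange (e : B ⊗[A] M ≃ₗ[B] N) (R : MinFreeRes A M) :
    (R.baseChange e).betti = R.betti := by
  funext n
  have := R.free n
  exact Module.finrank_baseChange (R := B) (S := A) (M' := R.F n)

/-- Complexity is preserved by flat local base change. -/
lemma complexity_baseChange (e : B ⊗[A] M ≃ₗ[B] N) (R : MinFreeRes A M) :
    complexity B N = complexity A M := by
  refine congrArg sInf (Set.ext fun t => exists_congr fun t' => and_congr_right fun _ => ⟨?_, ?_⟩)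
  · rintro ⟨R', hR'⟩
    rw [R'.betti_eq (R.baseChange e), R.betti_baseChange] at hR'
    exact ⟨R, hR'⟩
  · rintro ⟨R', hR'⟩
    rw [← R'.betti_baseChange e] at hR'
    exact ⟨_, hR'⟩

lemma IsSyzygy.baseChange (e : B ⊗[A] M ≃ₗ[B] N) {S : Type u} [AddCommGroup S] [Module A S]
    {n : ℕ} (h : IsSyzygy A M S n) : IsSyzygy B N (B ⊗[A] S) n := by
  cases n with
  | zero =>
    obtain ⟨φ⟩ := h
    exact ⟨φ.baseChange A B _ _ ≪≫ₗ e⟩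
  | succ n =>
    obtain ⟨R, ⟨φ⟩⟩ := h
    let i : B ⊗[A] S →ₗ[B] B ⊗[A] R.F n :=
      ((LinearMap.range (R.d n)).subtype ∘ₗ φ.toLinearMap).baseChange B
    have hi : Function.Injective i :=
      Module.Flat.lTensor_preserves_injective_linearMap (M := B) _
        ((Submodule.subtype_injective _).comp φ.injective)
    have hd : R.d n = ((LinearMap.range (R.d n)).subtype ∘ₗ φ.toLinearMap) ∘ₗ
        (φ.symm.toLinearMap ∘ₗ (R.d n).rangeRestrict) := by
      ext x
      simp
    have hr : LinearMap.range i = LinearMap.range ((R.d n).baseChange B) := by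
      conv_rhs => rw [hd, LinearMap.baseChange_comp]
      rw [LinearMap.range_comp_of_range_eq_top]
      exact LinearMap.range_eq_top.mpr (surjective_baseChange B
        (φ.symm.surjective.comp (R.d n).surjective_rangeRestrict))
    exact ⟨R.baseChange e, ⟨LinearEquiv.ofInjective i hi ≪≫ₗ LinearEquiv.ofEq _ _ hr⟩⟩

lemma ReducesWithDeg.baseChange {M K : ModuleCat.{u} A} {t : ℕ} (h : ReducesWithDeg A M K t)
    (N : ModuleCat.{u} B) (e : B ⊗[A] M ≃ₗ[B] N) :
    ReducesWithDeg B N (ModuleCat.of B (B ⊗[A] K)) t := by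
  obtain ⟨ht, S, _, _, hS, f, g, hf, hg, hfg⟩ := h
  refine ⟨ht, B ⊗[A] S, inferInstance, inferInstance, hS.baseChange e,
    f.baseChange B ∘ₗ e.symm.toLinearMap, g.baseChange B,
    (Module.Flat.lTensor_preserves_injective_linearMap (M := B) f hf).comp e.symm.injective,
    surjective_baseChange B hg, fun x => (exact_baseChange B hfg x).trans ?_⟩
  exact (e.symm.surjective.range_comp (f.baseChange B)).symm ▸ Iff.rfl

/-- Reducible complexity is preserved by flat local base change. -/
lemma HasRedCxCat.baseChange {M : ModuleCat.{u} A} (h : HasRedCxCat A M)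
    (N : ModuleCat.{u} B) (e : B ⊗[A] M ≃ₗ[B] N) : HasRedCxCat B N := by
  induction h generalizing N with
  | of_finite_pd M hM => exact .of_finite_pd N ((hM.baseChange B).of_equiv e)
  | of_step M K t h0 htop hred hlt _ ih =>
    obtain ⟨R⟩ := nonempty_minFreeRes_of_complexity_ne_top htop
    obtain ⟨RK⟩ := nonempty_minFreeRes_of_complexity_ne_top (hlt.trans_le le_top).ne
    have hN := complexity_baseChange e R
    have hK : complexity B (ModuleCat.of B (B ⊗[A] K)) = complexity A K :=
      complexity_baseChange (LinearEquiv.refl B (B ⊗[A] K)) RK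
    refine .of_step N (ModuleCat.of B (B ⊗[A] K)) t ?_ ?_ (hred.baseChange N e) ?_
      (ih _ (LinearEquiv.refl B (B ⊗[A] K)))
    · rwa [hN]
    · rwa [hN]
    · rwa [hN, hK]

/-- Finiteness of CI-dimension descends along flat local homomorphisms. -/
lemma HasFiniteCIDimMod.of_baseChange (e : B ⊗[A] M ≃ₗ[B] N) (h : HasFiniteCIDimMod B N) :
    HasFiniteCIDimMod A M := by
  obtain ⟨R, Q, _, _, _, _, f, g, hf, hg, hgs, hrs, hflat, hpd⟩ := h
  let : Algebra B R := f.toAlgebra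
  let : Algebra A R := (f.comp (algebraMap A B)).toAlgebra
  have : IsScalarTower A B R := .of_algebraMap_eq fun _ => rfl
  have : Module.Flat B R := hflat
  refine ⟨R, Q, _, _, ‹_›, ‹_›, f.comp (algebraMap A B), g, inferInstance, hg, hgs, hrs,
    Module.Flat.trans A B R, ?_⟩
  let e' : R ⊗[B] N ≃ₗ[R] R ⊗[A] M :=
    e.symm.baseChange B R _ _ ≪≫ₗ AlgebraTensorModule.cancelBaseChange A B R R M
  let : Module Q (R ⊗[B] N) := Module.compHom _ g
  let : Module Q (R ⊗[A] M) := Module.compHom _ g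
  let e'' : R ⊗[B] N ≃ₗ[Q] R ⊗[A] M :=
    { e' with map_smul' := fun q x => e'.map_smul (g q) x }
  exact hpd.of_equiv e''

end FlatLocalBaseChange

section PolynomialLocalization

open TensorProduct

variable (A : Type u) [CommRing A] [IsLocalRing A] (r : ℕ)

lemma algebraMap_polyLoc_eq (a : A) : algebraMap A (polyLoc A r) a =
    algebraMap (MvPolynomial (Fin r) A) (polyLoc A r) (MvPolynomial.C a) := by
  rw [IsScalarTower.algebraMap_apply A (MvPolynomial (Fin r) A) (polyLoc A r)]
  rfl

instance isLocalHom_algebraMap_polyLoc : IsLocalHom (algebraMap A (polyLoc A r)) where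
  map_nonunit a ha := by
    rw [algebraMap_polyLoc_eq, IsLocalization.AtPrime.isUnit_to_map_iff _ (polyMaxIdeal A r)] at ha
    by_contra h
    exact ha (by simpa [polyMaxIdeal, RingHom.mem_ker] using h)

instance flat_polyLoc : Module.Flat A (polyLoc A r) :=
  have : Module.Flat (MvPolynomial (Fin r) A) (polyLoc A r) :=
    IsLocalization.flat _ (polyMaxIdeal A r).primeCompl
  Module.Flat.trans A (MvPolynomial (Fin r) A) (polyLoc A r)

/-- The module `M'` is the base change of `M` along `A → A'`. -/
def polyLocTensorEquiv (M : Type u) [AddCommGroup M] [Module A M] :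
    polyLoc A r ⊗[A] M ≃ₗ[polyLoc A r] polyLocMod A M r :=
  (LocalizedModule.equivTensorProduct (polyMaxIdeal A r).primeCompl
    (MvPolynomial (Fin r) A ⊗[A] M) ≪≫ₗ
    AlgebraTensorModule.cancelBaseChange A (MvPolynomial (Fin r) A) (polyLoc A r)
      (polyLoc A r) M).symm

/-- The substitution `A[x₁, …, x_r] → k[x₁, …, x_r]` reducing coefficients to the residue
field `k` and sending the first `i` variables to zero. -/
def reduceAndKill (i : ℕ) :
    MvPolynomial (Fin r) A →+* MvPolynomial (Fin r) (ResidueField A) :=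
  MvPolynomial.eval₂Hom (MvPolynomial.C.comp (residue A))
    fun j => if (j : ℕ) < i then 0 else MvPolynomial.X j

lemma ker_reduceAndKill_self :
    RingHom.ker (reduceAndKill A r r) = polyMaxIdeal A r := by
  have h : reduceAndKill A r r = MvPolynomial.C.comp
      ((residue A).comp (MvPolynomial.aeval (0 : Fin r → A)).toRingHom) := by
    refine MvPolynomial.ringHom_ext (fun a => ?_) fun j => ?_
    · simp [reduceAndKill]
    · simp [reduceAndKill]
  rw [h, polyMaxIdeal]
  exact RingHom.ker_comp_of_injective _ (MvPolynomial.C_injective _ _)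

lemma ker_reduceAndKill_lt {i : ℕ} (hi : i < r) :
    RingHom.ker (reduceAndKill A r i) < RingHom.ker (reduceAndKill A r (i + 1)) := by
  let kill : MvPolynomial (Fin r) (ResidueField A) →+* MvPolynomial (Fin r) (ResidueField A) :=
    MvPolynomial.eval₂Hom MvPolynomial.C
      fun j => if (j : ℕ) < i + 1 then 0 else MvPolynomial.X j
  have h : reduceAndKill A r (i + 1) = kill.comp (reduceAndKill A r i) := by
    refine MvPolynomial.ringHom_ext (fun a => ?_) fun j => ?_
    · simp [reduceAndKill, kill]
    · by_cases hj : (j : ℕ) < i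
      · simp [reduceAndKill, kill, hj, hj.le]
      · simp [reduceAndKill, kill, hj]
  refine lt_of_le_of_ne (fun x hx => ?_) fun heq => ?_
  · rw [RingHom.mem_ker] at hx ⊢
    rw [h, RingHom.comp_apply, hx, map_zero]
  · have hX : (MvPolynomial.X ⟨i, hi⟩ : MvPolynomial (Fin r) A) ∈
        RingHom.ker (reduceAndKill A r i) := by
      rw [heq, RingHom.mem_ker]
      simp [reduceAndKill]
    rw [RingHom.mem_ker] at hX
    simp [reduceAndKill] at hX

lemma le_height_ker_reduceAndKill {i : ℕ} (hi : i ≤ r) :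
    (i : ℕ∞) ≤ (RingHom.ker (reduceAndKill A r i)).height := by
  induction i with
  | zero => simp
  | succ i ih =>
    have : (RingHom.ker (reduceAndKill A r i)).IsPrime := RingHom.ker_isPrime _
    have : (RingHom.ker (reduceAndKill A r (i + 1))).IsPrime := RingHom.ker_isPrime _
    push_cast
    exact (add_le_add_left (ih (by omega)) 1).trans
      (Ideal.height_add_one_le_of_lt_of_isPrime (ker_reduceAndKill_lt A r hi))

lemma ringKrullDim_polyLoc [IsArtinianRing A] :
    ringKrullDim (polyLoc A r) = (r : WithBot ℕ∞) := by
  rw [IsLocalization.AtPrime.ringKrullDim_eq_height (polyMaxIdeal A r)]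
  refine le_antisymm (Ideal.height_le_ringKrullDim_of_isPrime.trans ?_) ?_
  · rw [MvPolynomial.ringKrullDim_of_isNoetherianRing,
      ringKrullDimZero_iff_ringKrullDim_eq_zero.mp inferInstance]
    simp
  · rw [← ker_reduceAndKill_self]
    exact_mod_cast le_height_ker_reduceAndKill A r le_rfl

end PolynomialLocalization

/-- **Deformations (Remark 4.8).** Let `A` be a local artinian ring and `M` a finitely
generated `A`-module having reducible complexity, with complexity `c` and infinite
CI-dimension. Let `A'` be the localization of `A[x₁, …, x_r]` at the maximal ideal
generated by the maximal ideal of `A` and the variables, and `M'` the corresponding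
localization of `M[x₁, …, x_r]`. Then `M'` is a finitely generated module over the local
ring `A'` of Krull dimension `r`, and `M'` has reducible complexity, complexity `c`, and
infinite CI-dimension. -/
theorem deformation_of_reducible_complexity (A : Type u) [CommRing A] [IsLocalRing A]
    [IsArtinianRing A]
    (M : Type u) [AddCommGroup M] [Module A M] [Module.Finite A M]
    (c : ℕ) (hred : HasReducibleComplexity A M) (hc : complexity A M = (c : ℕ∞))
    (hci : ¬ HasFiniteCIDimMod A M) (r : ℕ) :
    IsLocalRing (polyLoc A r) ∧
    Module.Finite (polyLoc A r) (polyLocMod A M r) ∧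
    ringKrullDimE (polyLoc A r) = (r : WithBot ℕ∞) ∧
    HasReducibleComplexity (polyLoc A r) (polyLocMod A M r) ∧
    complexity (polyLoc A r) (polyLocMod A M r) = (c : ℕ∞) ∧
    ¬ HasFiniteCIDimMod (polyLoc A r) (polyLocMod A M r) := by
  have e := polyLocTensorEquiv A r M
  obtain ⟨R⟩ := nonempty_minFreeRes_of_complexity_ne_top (A := A) (M := M) (by simp [hc])
  exact ⟨inferInstance, .equiv e, ringKrullDim_polyLoc A r,
    HasRedCxCat.baseChange hred (ModuleCat.of (polyLoc A r) (polyLocMod A M r)) e,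
    (complexity_baseChange e R).trans hc, fun h => hci (h.of_baseChange e)⟩

end
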